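/- The function f(t,z) = ln(1 + 1/t)/z is jointly convex on the domain {(t,z) ∈ ℝ² : t > 0, z > 0}. -/

import Mathlib

open intervalIntegral in
lemma integral_inv_add_mul_inv {t : ℝ} (ht : 0 < t) (z : ℝ) :
    ∫ s in (0 : ℝ)..1, (t + s)⁻¹ * z⁻¹ = Real.log (1 + 1 / t) / z := by
  rw [integral_mul_const, integral_comp_add_left (fun s : ℝ => s⁻¹),
    integral_inv_of_pos (by linarith) (by linarith), div_eq_mul_inv (Real.log _)]
  congr 2
  field_simp
  ring

lemma intervalIntegrable_inv_add_mul_inv {t : ℝ} (ht : 0 < t) (z : ℝ) :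
    IntervalIntegrable (fun s => (t + s)⁻¹ * z⁻¹) MeasureTheory.volume 0 1 := by
  refine ContinuousOn.intervalIntegrable fun s hs => ContinuousAt.continuousWithinAt ?_
  rw [Set.uIcc_of_le zero_le_one] at hs
  have : t + s ≠ 0 := by linarith [hs.1]
  fun_prop (disch := assumption)

lemma mul_mul_three_sub_le_one {u v : ℝ} (hu : 0 < u) (hv : 0 < v) :
    u * v * (3 - u - v) ≤ 1 := by
  rcases le_total 3 (u + v) with h | h
  · nlinarith [mul_pos hu hv]
  · nlinarith [mul_nonneg (sub_nonneg.2 h) (sq_nonneg (u - v)),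
      mul_nonneg (add_pos hu hv).le (sq_nonneg (u + v - 2)), sq_nonneg (u + v - 2)]

/-- The tangent plane of `(x, z) ↦ x⁻¹ * z⁻¹` at `(X, Z)` lies below its graph. -/
lemma tangent_le_inv_mul_inv {x z X Z : ℝ} (hx : 0 < x) (hz : 0 < z) (hX : 0 < X) (hZ : 0 < Z) :
    X⁻¹ * Z⁻¹ * (3 - x / X - z / Z) ≤ x⁻¹ * z⁻¹ := by
  have h := mul_mul_three_sub_le_one (div_pos hx hX) (div_pos hz hZ)
  calc X⁻¹ * Z⁻¹ * (3 - x / X - z / Z)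
      = x⁻¹ * z⁻¹ * (x / X * (z / Z) * (3 - x / X - z / Z)) := by field_simp
    _ ≤ x⁻¹ * z⁻¹ * 1 := by gcongr
    _ = x⁻¹ * z⁻¹ := mul_one _

lemma convex_pos_prod_pos : Convex ℝ {p : ℝ × ℝ | 0 < p.1 ∧ 0 < p.2} :=
  (convex_Ioi (0 : ℝ)).prod (convex_Ioi (0 : ℝ))

lemma convexOn_inv_mul_inv :
    ConvexOn ℝ {p : ℝ × ℝ | 0 < p.1 ∧ 0 < p.2} (fun p : ℝ × ℝ => p.1⁻¹ * p.2⁻¹) := by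
  refine ⟨convex_pos_prod_pos, fun p hp q hq a b ha hb hab => ?_⟩
  obtain ⟨hX, hZ⟩ := convex_pos_prod_pos hp hq ha hb hab
  have h₁ := mul_le_mul_of_nonneg_left (tangent_le_inv_mul_inv hp.1 hp.2 hX hZ) ha
  have h₂ := mul_le_mul_of_nonneg_left (tangent_le_inv_mul_inv hq.1 hq.2 hX hZ) hb
  simp only [Prod.fst_add, Prod.snd_add, Prod.smul_fst, Prod.smul_snd, smul_eq_mul] at *
  refine le_trans (le_of_eq ?_) (add_le_add h₁ h₂)
  set X := a * p.1 + b * q.1 with hXdef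
  set Z := a * p.2 + b * q.2 with hZdef
  have e : a * (3 - p.1 / X - p.2 / Z) + b * (3 - q.1 / X - q.2 / Z) = 1 := by
    calc _ = 3 * (a + b) - (a * p.1 + b * q.1) / X - (a * p.2 + b * q.2) / Z := by ring
      _ = 1 := by rw [← hXdef, ← hZdef, hab, div_self hX.ne', div_self hZ.ne']; norm_num
  linear_combination -(X⁻¹ * Z⁻¹) * e

/-- The function `f(t,z) = ln(1 + 1/t)/z` is jointly convex on the domain
`{(t,z) : t > 0, z > 0}`. -/
theorem stmt_0 :
    ConvexOn ℝ {p : ℝ × ℝ | 0 < p.1 ∧ 0 < p.2}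
      (fun p : ℝ × ℝ => Real.log (1 + 1 / p.1) / p.2) := by
  refine ⟨convex_pos_prod_pos, fun p hp q hq a b ha hb hab => ?_⟩
  have hm := convex_pos_prod_pos hp hq ha hb hab
  have ip := (intervalIntegrable_inv_add_mul_inv hp.1 p.2).const_mul a
  have iq := (intervalIntegrable_inv_add_mul_inv hq.1 q.2).const_mul b
  simp only [smul_eq_mul]
  rw [← integral_inv_add_mul_inv hm.1, ← integral_inv_add_mul_inv hp.1,
    ← integral_inv_add_mul_inv hq.1, ← intervalIntegral.integral_const_mul,
    ← intervalIntegral.integral_const_mul, ← intervalIntegral.integral_add ip iq]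
  refine intervalIntegral.integral_mono_on zero_le_one
    (intervalIntegrable_inv_add_mul_inv hm.1 _) (ip.add iq) fun s hs => ?_
  have h := convexOn_inv_mul_inv.2 (x := (p.1 + s, p.2)) (y := (q.1 + s, q.2))
    ⟨add_pos_of_pos_of_nonneg hp.1 hs.1, hp.2⟩ ⟨add_pos_of_pos_of_nonneg hq.1 hs.1, hq.2⟩ ha hb hab
  have e : a * (p.1 + s) + b * (q.1 + s) = a * p.1 + b * q.1 + s := by
    linear_combination s * hab
  simpa [e] using h
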